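/- For every odd prime p there exists a finite group G of order 8p² together with irreducible complex characters χ and ψ of G such that ν₂(χ) = 1, ν₂(ψ) = −1, and ψ is an irreducible constituent of χ² (i.e. ⟨χ², ψ⟩ > 0). In particular, there are infinitely many finite groups G admitting an irreducible character χ with Frobenius–Schur indicator 1 whose square contains an irreducible constituent with Frobenius–Schur indicator −1. -/

import Mathlib

open scoped BigOperators
open scoped Classical

/-- A function `G → ℂ` is an irreducible character if it is the character of some
simple (finite-dimensional) complex representation. -/
def IsIrrChar {G : Type} [Group G] (χ : G → ℂ) : Prop :=
  ∃ W : FDRep ℂ G, CategoryTheory.Simple W ∧ W.character = χ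

/-- The Frobenius–Schur indicator `ν₂(χ) = (1/|G|) ∑_g χ(g²)`. -/
noncomputable def fsInd {G : Type*} [Group G] [Fintype G] (χ : G → ℂ) : ℂ :=
  (Fintype.card G : ℂ)⁻¹ * ∑ g : G, χ (g ^ 2)

/-- The standard inner product of class functions. -/
noncomputable def charInner {G : Type*} [Group G] [Fintype G] (χ ψ : G → ℂ) : ℂ :=
  (Fintype.card G : ℂ)⁻¹ * ∑ g : G, χ g * (starRingEnd ℂ) (ψ g)

/-- The trace of a matrix representation is an irreducible character if it has norm one. -/
theorem isIrrChar_trace {G : Type} [Group G] [Fintype G] {n : Type}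
    [Fintype n] [DecidableEq n] (M : G →* Matrix n n ℂ)
    (h : ∑ g : G, (M g).trace * (M g⁻¹).trace = Fintype.card G) :
    IsIrrChar fun g => (M g).trace := by
  let ρ : Representation ℂ G (n → ℂ) :=
    (Matrix.toLinAlgEquiv' : Matrix n n ℂ ≃ₐ[ℂ] _).toAlgHom.toMonoidHom.comp M
  have hρ : (FDRep.of ρ).character = fun g => (M g).trace := by
    ext g
    exact Matrix.trace_toLin'_eq (M g)
  refine ⟨FDRep.of ρ, ?_, hρ⟩
  rw [FDRep.simple_iff_char_is_norm_one, hρ, Nat.card_eq_fintype_card]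
  exact h

section Quaternion

open QuaternionGroup

variable {R : Type*} [CommRing R]

/-- A two-dimensional representation of `Q₈` over a ring in which `-1` is a sum of two squares. -/
def quaternionMatrix {a b : R} (h : a ^ 2 + b ^ 2 = -1) :
    QuaternionGroup 2 →* Matrix (Fin 2) (Fin 2) R where
  toFun
    | .a i => !![0, -1; 1, 0] ^ i.val
    | .xa i => !![a, b; b, -a] * !![0, -1; 1, 0] ^ i.val
  map_one' := pow_zero _
  map_mul' := by
    set I : Matrix (Fin 2) (Fin 2) R := !![0, -1; 1, 0] with hI
    set J : Matrix (Fin 2) (Fin 2) R := !![a, b; b, -a] with hJ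
    have hI2 : I ^ 2 = -1 := by
      ext i j; fin_cases i <;> fin_cases j <;> simp [hI, sq, Matrix.mul_apply]
    have hI4 : I ^ 4 = 1 := by rw [show 4 = 2 * 2 from rfl, pow_mul, hI2]; simp
    have hJ2 : J * J = I ^ 2 := by
      rw [hI2]
      ext i j; fin_cases i <;> fin_cases j <;> simp [hJ, Matrix.mul_apply] <;>
        first | ring1 | linear_combination h
    have hIJ : I * J = J * I ^ 3 := by
      rw [pow_succ, hI2]
      ext i j; fin_cases i <;> fin_cases j <;> simp [hI, hJ, Matrix.mul_apply]
    have hpow (n : ℕ) : I ^ (n % 4) = I ^ n := (pow_eq_pow_mod n hI4).symm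
    have hcomm (n : ℕ) : I ^ n * J = J * I ^ (3 * n) := by
      rw [pow_mul]
      exact SemiconjBy.eq (SemiconjBy.pow_right (a := J) hIJ.symm n) |>.symm
    have hval (n : ℕ) : I ^ (n : ZMod (2 * 2)).val = I ^ n := by
      rw [ZMod.val_natCast]; exact hpow n
    have hneg (i : ZMod (2 * 2)) : -i = ((3 * i.val : ℕ) : ZMod (2 * 2)) := by
      revert i; decide
    have hsub (i j : ZMod (2 * 2)) : I ^ (j - i).val = I ^ (3 * i.val) * I ^ j.val := by
      rw [← pow_add, ← hval (_ + _), Nat.cast_add, ← hneg, ZMod.natCast_zmod_val, neg_add_eq_sub]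
    have hadd (i j : ZMod (2 * 2)) : I ^ (i + j).val = I ^ i.val * I ^ j.val := by
      rw [← pow_add, ← hval (_ + _), Nat.cast_add, ZMod.natCast_zmod_val, ZMod.natCast_zmod_val]
    rintro (i | i) (j | j)
    · simp only [a_mul_a, hadd]
    · simp only [a_mul_xa, hsub, ← mul_assoc, hcomm]
    · simp only [xa_mul_a, hadd, mul_assoc]
    · simp only [xa_mul_xa, add_sub_assoc, hadd, hsub, hval]
      rw [mul_assoc, ← mul_assoc (I ^ i.val), hcomm]
      simp only [← mul_assoc, hJ2]

theorem quaternionMatrix_a {a b : R} (h : a ^ 2 + b ^ 2 = -1) (i : ZMod (2 * 2)) :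
    quaternionMatrix h (.a i) = !![0, -1; 1, 0] ^ i.val := rfl

theorem quaternionMatrix_xa {a b : R} (h : a ^ 2 + b ^ 2 = -1) (i : ZMod (2 * 2)) :
    quaternionMatrix h (.xa i) = !![a, b; b, -a] * !![0, -1; 1, 0] ^ i.val := rfl

theorem quaternionMatrix_a_two {a b : R} (h : a ^ 2 + b ^ 2 = -1) :
    quaternionMatrix h (.a 2) = -1 := by
  rw [quaternionMatrix_a, show (2 : ZMod (2 * 2)).val = 2 from rfl]
  ext i j; fin_cases i <;> fin_cases j <;> simp [sq, Matrix.mul_apply]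

theorem trace_quaternionMatrix {a b : R} (h : a ^ 2 + b ^ 2 = -1) (q : QuaternionGroup 2) :
    (quaternionMatrix h q).trace = if q = 1 then 2 else if q = .a 2 then -2 else 0 := by
  have hz (i : ZMod (2 * 2)) : i = 0 ∨ i = 1 ∨ i = 2 ∨ i = 3 := by revert i; decide
  have h3 : (3 : ZMod (2 * 2)).val = 3 := rfl
  have h2 : (2 : ZMod (2 * 2)).val = 2 := rfl
  have h1 : (1 : ZMod (2 * 2)).val = 1 := rfl
  rcases q with i | i
  · rw [quaternionMatrix_a]
    rcases hz i with rfl | rfl | rfl | rfl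
    · simp
    · rw [if_neg (by decide), if_neg (by decide), h1]
      simp [Matrix.trace_fin_two]
    · rw [if_neg (by decide), if_pos rfl, h2]
      simp [pow_succ, Matrix.trace_fin_two]
      norm_num
    · rw [if_neg (by decide), if_neg (by decide), h3]
      simp [pow_succ, Matrix.trace_fin_two]
  · rw [quaternionMatrix_xa, if_neg (by rintro ⟨⟩), if_neg (by rintro ⟨⟩)]
    rcases hz i with rfl | rfl | rfl | rfl
    · simp [Matrix.trace_fin_two]
    · rw [h1]; simp [Matrix.trace_fin_two]
    · rw [h2]; simp [pow_succ, Matrix.trace_fin_two]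
    · rw [h3]; simp [pow_succ, Matrix.trace_fin_two]

theorem det_quaternionMatrix {a b : R} (h : a ^ 2 + b ^ 2 = -1) (q : QuaternionGroup 2) :
    (quaternionMatrix h q).det = 1 := by
  rcases q with i | i
  · simp [quaternionMatrix_a, Matrix.det_fin_two_of]
  · simp only [quaternionMatrix_xa, Matrix.det_mul, Matrix.det_pow, Matrix.det_fin_two_of]
    linear_combination -h

theorem isUnit_quaternionMatrix_add_one {F : Type*} [Field F] (h2 : (2 : F) ≠ 0) {a b : F}
    (h : a ^ 2 + b ^ 2 = -1) {q : QuaternionGroup 2} (hq : q ≠ .a 2) :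
    IsUnit (quaternionMatrix h q + 1) := by
  have hdet : (quaternionMatrix h q + 1).det = 2 + (quaternionMatrix h q).trace := by
    have := det_quaternionMatrix h q
    simp only [Matrix.det_fin_two, Matrix.trace_fin_two, Matrix.add_apply] at this ⊢
    simp
    linear_combination this
  rw [Matrix.isUnit_iff_isUnit_det, isUnit_iff_ne_zero, hdet, trace_quaternionMatrix]
  split_ifs
  · rw [← two_mul]; exact mul_ne_zero h2 h2
  · simpa

end Quaternion

section Induced

open Matrix

variable {n R H : Type*} [Fintype n] [DecidableEq n] [CommRing R] [Group H]

/-- The action by automorphisms on column vectors given by a matrix representation. -/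
def mulVecMulAut (M : H →* Matrix n n R) : H →* MulAut (Multiplicative (n → R)) where
  toFun q :=
    { toFun v := .ofAdd (M q *ᵥ v.toAdd)
      invFun v := .ofAdd (M q⁻¹ *ᵥ v.toAdd)
      left_inv v := by simp [mulVec_mulVec, ← map_mul]
      right_inv v := by simp [mulVec_mulVec, ← map_mul]
      map_mul' v w := by simp [mulVec_add] }
  map_one' := by ext1 v; simp
  map_mul' q r := by ext1 v; simp [mulVec_mulVec]

@[simp]
theorem mulVecMulAut_apply (M : H →* Matrix n n R) (q : H) (v : Multiplicative (n → R)) :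
    mulVecMulAut M q v = .ofAdd (M q *ᵥ v.toAdd) := rfl

variable [Fintype H] [DecidableEq H]

/-- The matrix representation of `Rⁿ ⋊ H` induced by a linear character of `Rⁿ`. -/
noncomputable def inducedMatrix (M : H →* Matrix n n R) (l : AddChar (n → R) ℂ) :
    Multiplicative (n → R) ⋊[mulVecMulAut M] H →* Matrix H H ℂ where
  toFun g := .of fun r s => if g.right * s = r then l (M r⁻¹ *ᵥ g.left.toAdd) else 0
  map_one' := by
    ext r s
    simp [Matrix.one_apply, eq_comm]
  map_mul' g h := by
    ext r s
    simp only [Matrix.mul_apply, of_apply, ite_mul, zero_mul, mul_ite, mul_zero]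
    rw [Finset.sum_eq_single (h.right * s)]
    · by_cases hr : g.right * h.right * s = r
      · subst hr
        simp [mul_assoc, mulVec_add, AddChar.map_add_eq_mul, mulVec_mulVec, ← map_mul]
      · simp [hr, ← mul_assoc]
    · intro t _ ht
      simp [ht.symm]
    · simp

theorem trace_inducedMatrix (M : H →* Matrix n n R) (l : AddChar (n → R) ℂ)
    (g : Multiplicative (n → R) ⋊[mulVecMulAut M] H) :
    (inducedMatrix M l g).trace =
      if g.right = 1 then ∑ r, l (M r *ᵥ g.left.toAdd) else 0 := by
  simp only [Matrix.trace, inducedMatrix, MonoidHom.coe_mk, OneHom.coe_mk, diag_apply, of_apply,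
    mul_eq_right]
  split_ifs
  · exact Fintype.sum_equiv (Equiv.inv H) _ _ fun r => rfl
  · simp

theorem sum_addChar_mulVec [Fintype R] {l : AddChar (n → R) ℂ} (hl : l ≠ 0)
    {A : Matrix n n R} (hA : IsUnit A) : ∑ v, l (A *ᵥ v) = 0 := by
  rw [← AddChar.sum_eq_zero_iff_ne_zero.mpr hl]
  exact Fintype.sum_bijective _ (Finite.injective_iff_bijective.mp (mulVec_injective_of_isUnit hA)) _ _
    fun _ => rfl

end Induced

noncomputable instance {N H : Type*} [Group N] [Group H] [Fintype N] [Fintype H]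
    (φ : H →* MulAut N) : Fintype (N ⋊[φ] H) :=
  Fintype.ofEquiv _ SemidirectProduct.equivProd.symm

theorem SemidirectProduct.sum_eq {N H A : Type*} [Group N] [Group H] [Fintype N] [Fintype H]
    [AddCommMonoid A] {φ : H →* MulAut N} (f : N ⋊[φ] H → A) :
    ∑ g, f g = ∑ q : H, ∑ v : N, f ⟨v, q⟩ := by
  rw [← Fintype.sum_prod_type_right']
  exact Fintype.sum_equiv SemidirectProduct.equivProd _ _ fun _ => rfl

section QuaternionExtension

open Matrix

variable {n R : Type} [Fintype n] [DecidableEq n] [CommRing R]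
  {M : QuaternionGroup 2 →* Matrix n n R} {l : AddChar (n → R) ℂ}

theorem orbitSum_neg (hz : M (.a 2) = -1) (v : n → R) :
    ∑ r, l (M r *ᵥ (-v)) = ∑ r, l (M r *ᵥ v) :=
  Fintype.sum_equiv (Equiv.mulRight (.a 2)) _ _ fun r => by simp [hz, mulVec_neg, neg_mulVec]

variable [Fintype R]

theorem sum_addChar_mul_addChar (hz : M (.a 2) = -1)
    (hu : ∀ q ≠ .a 2, IsUnit (M q + 1)) (hl : l ≠ 0) (r s : QuaternionGroup 2) :
    ∑ v, l (M r *ᵥ v) * l (M s *ᵥ v) =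
      if s = r * .a 2 then (Fintype.card (n → R) : ℂ) else 0 := by
  have hrs (v : n → R) : l (M r *ᵥ v) * l (M s *ᵥ v) = l ((M r * (M (r⁻¹ * s) + 1)) *ᵥ v) := by
    rw [← AddChar.map_add_eq_mul, ← add_mulVec, mul_add, ← map_mul, mul_inv_cancel_left, mul_one,
      add_comm]
  simp_rw [hrs]
  split_ifs with h
  · simp [h, hz]
  · exact sum_addChar_mulVec hl
      (((Group.isUnit r).map M).mul (hu _ fun h' => h (inv_mul_eq_iff_eq_mul.mp h')))

theorem sum_orbitSum_sq (hz : M (.a 2) = -1)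
    (hu : ∀ q ≠ .a 2, IsUnit (M q + 1)) (hl : l ≠ 0) :
    ∑ v, (∑ r, l (M r *ᵥ v)) * ∑ r, l (M r *ᵥ v) = 8 * (Fintype.card (n → R) : ℂ) := by
  simp_rw [Finset.sum_mul_sum]
  rw [Finset.sum_comm]
  simp_rw [Finset.sum_comm (s := (Finset.univ : Finset (n → R))),
    sum_addChar_mul_addChar hz hu hl]
  simp [QuaternionGroup.card]

theorem card_extension (M : QuaternionGroup 2 →* Matrix n n R) :
    Fintype.card (Multiplicative (n → R) ⋊[mulVecMulAut M] QuaternionGroup 2) =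
      8 * Fintype.card (n → R) := by
  rw [Fintype.card_congr SemidirectProduct.equivProd, Fintype.card_prod, QuaternionGroup.card,
    Fintype.card_multiplicative, mul_comm]

theorem sum_inducedMatrix_sq (hz : M (.a 2) = -1)
    (hu : ∀ q ≠ .a 2, IsUnit (M q + 1)) (hl : l ≠ 0) :
    ∑ v : Multiplicative (n → R), (∑ r, l (M r *ᵥ v.toAdd)) * ∑ r, l (M r *ᵥ v.toAdd) =
      8 * (Fintype.card (n → R) : ℂ) := by
  rw [← sum_orbitSum_sq hz hu hl]
  exact Fintype.sum_equiv Multiplicative.toAdd _ _ fun _ => rfl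

theorem isIrrChar_trace_inducedMatrix (hz : M (.a 2) = -1)
    (hu : ∀ q ≠ .a 2, IsUnit (M q + 1)) (hl : l ≠ 0) :
    IsIrrChar fun g => (inducedMatrix M l g).trace := by
  apply isIrrChar_trace
  rw [SemidirectProduct.sum_eq, Fintype.sum_eq_single 1, card_extension]
  · simp only [trace_inducedMatrix, SemidirectProduct.inv_left, SemidirectProduct.inv_right]
    simp [orbitSum_neg hz, sum_inducedMatrix_sq hz hu hl]
  · intro q hq
    simp only [trace_inducedMatrix, if_neg hq, zero_mul, Finset.sum_const_zero]

theorem fsInd_trace_inducedMatrix (hz : M (.a 2) = -1)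
    (hu : ∀ q ≠ .a 2, IsUnit (M q + 1)) (hl : l ≠ 0) :
    fsInd (fun g => (inducedMatrix M l g).trace) = 1 := by
  have hsq (q : QuaternionGroup 2) : q * q = 1 ↔ q = 1 ∨ q = .a 2 := by
    revert q; decide
  have h0 : ∑ v : Multiplicative (n → R),
      (inducedMatrix M l (⟨v, 1⟩ ^ 2)).trace = 0 := by
    simp only [sq, trace_inducedMatrix, SemidirectProduct.mul_right, mul_one, if_true,
      SemidirectProduct.mul_left, map_one, MulAut.one_apply, toAdd_mul]
    rw [Finset.sum_comm]
    refine Finset.sum_eq_zero fun r _ => ?_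
    rw [← sum_addChar_mulVec hl (((Group.isUnit r).map M).mul (hu 1 (by decide)))]
    refine Fintype.sum_equiv Multiplicative.toAdd _ _ fun v => ?_
    simp [mul_add, mulVec_add, add_mulVec]
  have h2 : ∑ v : Multiplicative (n → R),
      (inducedMatrix M l (⟨v, .a 2⟩ ^ 2)).trace = 8 * (Fintype.card (n → R) : ℂ) := by
    simp only [sq, trace_inducedMatrix, SemidirectProduct.mul_right,
      SemidirectProduct.mul_left, (hsq (.a 2)).mpr (.inr rfl), if_true]
    simp [hz, neg_mulVec, QuaternionGroup.card, mul_comm]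
  rw [fsInd, SemidirectProduct.sum_eq, Fintype.sum_eq_add 1 (.a 2) (by decide), h0, h2,
    card_extension, zero_add]
  · push_cast
    exact inv_mul_cancel₀ (by simp)
  · rintro q hq
    refine Finset.sum_eq_zero fun v _ => ?_
    rw [trace_inducedMatrix, if_neg]
    rw [sq, SemidirectProduct.mul_right, hsq]
    tauto

/-- The degree-two irreducible representation of `Q₈`. -/
noncomputable def complexQuaternionMatrix : QuaternionGroup 2 →* Matrix (Fin 2) (Fin 2) ℂ :=
  quaternionMatrix (a := Complex.I) (b := 0) (by simp)

theorem sum_trace_sq :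
    ∑ q, (complexQuaternionMatrix q).trace * (complexQuaternionMatrix q⁻¹).trace = 8 := by
  rw [Fintype.sum_eq_add 1 (.a 2) (by decide)]
  · have : (QuaternionGroup.a 2 : QuaternionGroup 2)⁻¹ = .a 2 := by decide
    simp only [complexQuaternionMatrix, trace_quaternionMatrix, this, inv_one]
    rw [if_pos trivial, if_neg (by decide), if_pos trivial]
    norm_num
  · rintro q ⟨h1, h2⟩
    simp [complexQuaternionMatrix, trace_quaternionMatrix, h1, h2]

theorem isIrrChar_trace_rightHom (M : QuaternionGroup 2 →* Matrix n n R) :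
    IsIrrChar fun g : Multiplicative (n → R) ⋊[mulVecMulAut M] QuaternionGroup 2 =>
      (complexQuaternionMatrix g.right).trace := by
  refine isIrrChar_trace (complexQuaternionMatrix.comp SemidirectProduct.rightHom) ?_
  rw [SemidirectProduct.sum_eq, card_extension]
  simp [← Finset.mul_sum, sum_trace_sq, mul_comm]

theorem fsInd_trace_rightHom (M : QuaternionGroup 2 →* Matrix n n R) :
    fsInd (fun g : Multiplicative (n → R) ⋊[mulVecMulAut M] QuaternionGroup 2 =>
      (complexQuaternionMatrix g.right).trace) = -1 := by
  have hsum : ∑ q, (complexQuaternionMatrix (q * q)).trace = -8 := by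
    have hsq (q : QuaternionGroup 2) :
        q * q = if q = 1 ∨ q = .a 2 then 1 else .a 2 := by
      revert q; decide
    have hcard : (Finset.univ.filter fun q : QuaternionGroup 2 => q = 1 ∨ q = .a 2).card = 2 := by
      decide
    have hcard' :
        (Finset.univ.filter fun q : QuaternionGroup 2 => ¬ (q = 1 ∨ q = .a 2)).card = 6 := by
      decide
    have hne : (QuaternionGroup.a 2 : QuaternionGroup 2) ≠ 1 := by decide
    have htr (q : QuaternionGroup 2) : (complexQuaternionMatrix (q * q)).trace =
        if q = 1 ∨ q = .a 2 then 2 else -2 := by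
      rw [hsq, complexQuaternionMatrix, trace_quaternionMatrix]
      split_ifs <;> simp_all
    simp only [htr, Finset.sum_ite, Finset.sum_const, hcard, hcard']
    norm_num
  rw [fsInd, SemidirectProduct.sum_eq, card_extension]
  simp only [sq, SemidirectProduct.mul_right, Finset.sum_const, ← Finset.smul_sum, hsum]
  have : (Fintype.card (n → R) : ℂ) ≠ 0 := Nat.cast_ne_zero.mpr Fintype.card_ne_zero
  simp
  field_simp

theorem charInner_inducedMatrix_sq (hz : M (.a 2) = -1)
    (hu : ∀ q ≠ .a 2, IsUnit (M q + 1)) (hl : l ≠ 0) :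
    charInner (fun g => (inducedMatrix M l g).trace * (inducedMatrix M l g).trace)
      (fun g => (complexQuaternionMatrix g.right).trace) = 2 := by
  rw [charInner, SemidirectProduct.sum_eq, Fintype.sum_eq_single 1, card_extension]
  · have : (Fintype.card (n → R) : ℂ) ≠ 0 := Nat.cast_ne_zero.mpr Fintype.card_ne_zero
    simp only [trace_inducedMatrix, if_true, ← Finset.sum_mul, sum_inducedMatrix_sq hz hu hl]
    simp [Complex.conj_ofNat]
    field_simp
  · intro q hq
    simp only [trace_inducedMatrix, if_neg hq, zero_mul, Finset.sum_const_zero]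

end QuaternionExtension

theorem exists_irrChar_quaternion_extension (p : ℕ) (hp : p.Prime) (hodd : Odd p) :
    ∃ (G : Type) (_ : Group G) (_ : Fintype G), Fintype.card G = 8 * p ^ 2 ∧
      ∃ χ ψ : G → ℂ, IsIrrChar χ ∧ IsIrrChar ψ ∧ fsInd χ = 1 ∧ fsInd ψ = -1 ∧
        ∃ n : ℕ, 0 < n ∧ charInner (fun g => χ g * χ g) ψ = n := by
  have : Fact p.Prime := ⟨hp⟩
  obtain ⟨a, b, h⟩ := ZMod.sq_add_sq p (-1)
  have h2 : (2 : ZMod p) ≠ 0 := by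
    have : Fact (2 < p) := ⟨hp.two_le.lt_of_ne' (by rintro rfl; exact absurd hodd (by decide))⟩
    exact Ring.two_ne_zero (by rw [ZMod.ringChar_zmod_n]; exact (Fact.out : 2 < p).ne')
  let l : AddChar (Fin 2 → ZMod p) ℂ :=
    ZMod.stdAddChar.compAddMonoidHom (Pi.evalAddMonoidHom _ 0)
  have hl : l ≠ 0 := by
    rw [AddChar.ne_zero_iff]
    refine ⟨Pi.single 0 1, fun h1 => one_ne_zero (α := ZMod p) (ZMod.injective_stdAddChar ?_)⟩
    simpa [l] using h1
  have hz := quaternionMatrix_a_two h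
  have hu := fun q hq => isUnit_quaternionMatrix_add_one h2 h (q := q) hq
  exact ⟨_, inferInstance, inferInstance, by rw [card_extension]; simp, _, _,
    isIrrChar_trace_inducedMatrix hz hu hl, isIrrChar_trace_rightHom _,
    fsInd_trace_inducedMatrix hz hu hl, fsInd_trace_rightHom _, 2, two_pos,
    by exact_mod_cast charInner_inducedMatrix_sq hz hu hl⟩

/-- For every odd prime `p` there is a finite group `G` of order `8p²`
with irreducible complex characters `χ` and `ψ` such that `ν₂(χ) = 1`, `ν₂(ψ) = -1`, and
`ψ` is an irreducible constituent of `χ²` (`⟨χ², ψ⟩ > 0`).  In particular, there are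
infinitely many finite groups (here: groups of infinitely many different orders) admitting
an irreducible character with Frobenius–Schur indicator 1 whose square contains an
irreducible constituent with Frobenius–Schur indicator -1. -/
theorem infinitely_many_counterexamples :
    (∀ p : ℕ, p.Prime → Odd p →
      ∃ (G : Type) (instG : Group G) (instF : Fintype G),
        @Fintype.card G instF = 8 * p ^ 2 ∧
        ∃ χ ψ : G → ℂ,
          @IsIrrChar G instG χ ∧ @IsIrrChar G instG ψ ∧
          @fsInd G instG instF χ = 1 ∧ @fsInd G instG instF ψ = -1 ∧
          ∃ n : ℕ, 0 < n ∧
            @charInner G instG instF (fun g => χ g * χ g) ψ = n) ∧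
    {m : ℕ | ∃ (G : Type) (instG : Group G) (instF : Fintype G),
        @Fintype.card G instF = m ∧
        ∃ χ ψ : G → ℂ,
          @IsIrrChar G instG χ ∧ @IsIrrChar G instG ψ ∧
          @fsInd G instG instF χ = 1 ∧ @fsInd G instG instF ψ = -1 ∧
          ∃ n : ℕ, 0 < n ∧
            @charInner G instG instF (fun g => χ g * χ g) ψ = n}.Infinite := by
  refine ⟨exists_irrChar_quaternion_extension, Set.infinite_of_forall_exists_gt fun n => ?_⟩
  obtain ⟨p, hle, hp⟩ := Nat.exists_infinite_primes (n + 3)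
  obtain ⟨G, instG, instF, hcard, h⟩ :=
    exists_irrChar_quaternion_extension p hp (hp.odd_of_ne_two (by lia))
  exact ⟨8 * p ^ 2, ⟨G, instG, instF, hcard, h⟩, by nlinarith⟩
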